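/- arXiv:2006.06364 — 4 statements merged into one kernel-verified Lean document; each statement's English description precedes it below -/
import Mathlib

section
/- For all real μ₁, μ₂ and all σ₁ > 0, σ₂ > 0, the Bhattacharyya coefficient of two Gaussian densities satisfies the closed-form identity ∫_ℝ √(f(x|μ₁,σ₁)·f(x|μ₂,σ₂)) dx = √(2σ₁σ₂/(σ₁²+σ₂²)) · exp(−(μ₁−μ₂)²/(4(σ₁²+σ₂²))). (This is the fidelity ‖√ρ₁√ρ₂‖₁ of two position-diagonal Gaussian density operators, Eq. (17) of the paper.) -/
open MeasureTheory Real

/-- The Gaussian probability density with mean `μ` and standard deviation `σ`. -/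
noncomputable def gaussianPDF (μ σ x : ℝ) : ℝ :=
  (1 / (Real.sqrt (2 * Real.pi) * σ)) * Real.exp (-(x - μ)^2 / (2 * σ^2))

/-- Closed form for the Bhattacharyya coefficient (fidelity) of two Gaussian densities. -/
theorem gaussian_bhattacharyya_closed_form (μ₁ μ₂ σ₁ σ₂ : ℝ) (hσ₁ : 0 < σ₁) (hσ₂ : 0 < σ₂) :
    ∫ x : ℝ, Real.sqrt (gaussianPDF μ₁ σ₁ x * gaussianPDF μ₂ σ₂ x)
      = Real.sqrt (2 * σ₁ * σ₂ / (σ₁^2 + σ₂^2))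
        * Real.exp (-(μ₁ - μ₂)^2 / (4 * (σ₁^2 + σ₂^2))) := by
  have hS : 0 < σ₁^2 + σ₂^2 := by positivity
  have key : ∀ x : ℝ, Real.sqrt (gaussianPDF μ₁ σ₁ x * gaussianPDF μ₂ σ₂ x)
      = (Real.sqrt (1 / (2 * Real.pi * σ₁ * σ₂))
        * Real.exp (-(μ₁ - μ₂)^2 / (4 * (σ₁^2 + σ₂^2))))
        * Real.exp (-((σ₁^2 + σ₂^2) / (4 * σ₁^2 * σ₂^2))
          * (x - (μ₁ * σ₂^2 + μ₂ * σ₁^2) / (σ₁^2 + σ₂^2))^2) := by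
    intro x
    have h2 : Real.sqrt (2 * Real.pi) * Real.sqrt (2 * Real.pi) = 2 * Real.pi :=
      Real.mul_self_sqrt (by positivity)
    have hE : -(x - μ₁)^2 / (2 * σ₁^2) + -(x - μ₂)^2 / (2 * σ₂^2)
        = (-(μ₁ - μ₂)^2 / (4 * (σ₁^2 + σ₂^2)) + -((σ₁^2 + σ₂^2) / (4 * σ₁^2 * σ₂^2))
          * (x - (μ₁ * σ₂^2 + μ₂ * σ₁^2) / (σ₁^2 + σ₂^2))^2)
        + (-(μ₁ - μ₂)^2 / (4 * (σ₁^2 + σ₂^2)) + -((σ₁^2 + σ₂^2) / (4 * σ₁^2 * σ₂^2))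
          * (x - (μ₁ * σ₂^2 + μ₂ * σ₁^2) / (σ₁^2 + σ₂^2))^2) := by
      field_simp
      ring
    have hP : gaussianPDF μ₁ σ₁ x * gaussianPDF μ₂ σ₂ x
        = (1 / (2 * Real.pi * σ₁ * σ₂))
          * Real.exp (-(x - μ₁)^2 / (2 * σ₁^2) + -(x - μ₂)^2 / (2 * σ₂^2)) := by
      have h3 : 1 / (2 * Real.pi * σ₁ * σ₂)
          = (1 / (Real.sqrt (2 * Real.pi) * σ₁)) * (1 / (Real.sqrt (2 * Real.pi) * σ₂)) := by
        rw [div_mul_div_comm, one_mul]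
        congr 1
        linear_combination (-(σ₁ * σ₂)) * h2
      rw [h3, Real.exp_add]
      unfold gaussianPDF
      ring
    rw [hP, hE, Real.exp_add (_ + _), Real.sqrt_mul (by positivity),
      Real.sqrt_mul_self (Real.exp_pos _).le, Real.exp_add, ← mul_assoc]
  simp_rw [key]
  rw [integral_const_mul,
    integral_sub_right_eq_self (fun x : ℝ => Real.exp (-((σ₁^2 + σ₂^2) / (4 * σ₁^2 * σ₂^2)) * x^2)),
    integral_gaussian, mul_right_comm, ← Real.sqrt_mul (by positivity)]
  congr 2
  field_simp
  try norm_num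
end

section
/- Fix μ₁, μ₂ ∈ ℝ and σ₂ > 0. Then the Bhattacharyya coefficient ∫_ℝ √(f(x|μ₁,σ₁)·f(x|μ₂,σ₂)) dx tends to 0 as σ₁ → ∞; i.e., two Gaussian conditional states become asymptotically perfectly distinguishable when one spread is larger than the other by arbitrarily many orders of magnitude, even with coinciding means. -/
open MeasureTheory Real Filter

/-- The Bhattacharyya coefficient of two Gaussian densities tends to `0` as one of the
spreads tends to infinity, even with coinciding means: widely different spreads make
Gaussian conditional states asymptotically perfectly distinguishable. -/
theorem gaussian_bhattacharyya_tendsto_zero_of_spread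
    (μ₁ μ₂ σ₂ : ℝ) (hσ₂ : 0 < σ₂) :
    Tendsto (fun σ₁ : ℝ => ∫ x : ℝ, Real.sqrt (gaussianPDF μ₁ σ₁ x * gaussianPDF μ₂ σ₂ x))
      Filter.atTop (nhds 0) := by
  have hint : Integrable (fun x : ℝ => Real.sqrt (gaussianPDF μ₂ σ₂ x)) := by
    have h0 : Integrable (fun x : ℝ => Real.exp (-(1 / (4 * σ₂ ^ 2)) * x ^ 2)) :=
      integrable_exp_neg_mul_sq (by positivity)
    have h1 := (h0.comp_sub_right μ₂).const_mul (Real.sqrt (1 / (Real.sqrt (2 * Real.pi) * σ₂)))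
    refine h1.congr (Filter.Eventually.of_forall fun x => ?_)
    have hc : 0 ≤ 1 / (Real.sqrt (2 * Real.pi) * σ₂) := by positivity
    simp only [gaussianPDF]
    rw [Real.sqrt_mul hc, ← Real.exp_half]
    congr 2
    field_simp
    ring
  have hlim : Tendsto (fun σ₁ : ℝ => Real.sqrt (1 / (Real.sqrt (2 * Real.pi) * σ₁)) *
      ∫ x : ℝ, Real.sqrt (gaussianPDF μ₂ σ₂ x)) Filter.atTop (nhds 0) := by
    have h1 : Tendsto (fun σ₁ : ℝ => 1 / (Real.sqrt (2 * Real.pi) * σ₁))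
        Filter.atTop (nhds 0) := by
      simp only [one_div]
      exact (tendsto_id.const_mul_atTop (by positivity)).inv_tendsto_atTop
    have h2 := (h1.sqrt).mul_const (∫ x : ℝ, Real.sqrt (gaussianPDF μ₂ σ₂ x))
    simpa only [Real.sqrt_zero, zero_mul] using h2
  refine squeeze_zero' (Filter.Eventually.of_forall fun σ₁ =>
    integral_nonneg fun x => Real.sqrt_nonneg _) ?_ hlim
  filter_upwards [Filter.eventually_gt_atTop (0 : ℝ)] with σ₁ hσ₁
  rw [← integral_const_mul]
  refine integral_mono_of_nonneg (Filter.Eventually.of_forall fun x => Real.sqrt_nonneg _)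
    (hint.const_mul _) (Filter.Eventually.of_forall fun x => ?_)
  have hc : 0 ≤ 1 / (Real.sqrt (2 * Real.pi) * σ₁) := by positivity
  have h2 : 0 ≤ gaussianPDF μ₂ σ₂ x := by unfold gaussianPDF; positivity
  have h1 : gaussianPDF μ₁ σ₁ x ≤ 1 / (Real.sqrt (2 * Real.pi) * σ₁) := by
    unfold gaussianPDF
    refine mul_le_of_le_one_right hc (Real.exp_le_one_iff.mpr ?_)
    exact div_nonpos_of_nonpos_of_nonneg (by nlinarith [sq_nonneg (x - μ₁)]) (by positivity)
  show Real.sqrt _ ≤ Real.sqrt _ * Real.sqrt _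
  rw [← Real.sqrt_mul hc]
  exact Real.sqrt_le_sqrt (mul_le_mul_of_nonneg_right h1 h2)
end

section
/- Let a_i, a_j, m_i, m_j ∈ ℝ and α_i, α_j, s_i, s_j > 0. For each index ℓ ∈ {i,j} define the kernel K_ℓ(q,q′) = ∫_ℝ f(−u|a_ℓ,α_ℓ)·√(f(q−u|m_ℓ,s_ℓ)·f(q′−u|m_ℓ,s_ℓ)) du. Then the overlap (linear fidelity) satisfies ∫_ℝ∫_ℝ K_i(q,q′)·K_j(q′,q) dq dq′ = 2 s_i s_j · exp(−(a_i−m_i−a_j+m_j)² / (2(α_i²+α_j²+s_i²+s_j²))) / √((s_i²+s_j²)(α_i²+α_j²+s_i²+s_j²)). (This is Eq. (31), the overlap Tr[ρ_{S|i}ρ_{S|j}] of conditional system states in the quantum reference frame of environment E₁.) -/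
open MeasureTheory Real

/-- The position-representation kernel of the mixed conditional system state obtained by
mixing Gaussian wave-packets (mean `m`, spread `s`) whose centre is shifted by a
Gaussian-distributed random amount (mean `a`, spread `α`). -/
noncomputable def condKernel (a α m s : ℝ) (q q' : ℝ) : ℝ :=
  ∫ u : ℝ, gaussianPDF a α (-u) *
    Real.sqrt (gaussianPDF m s (q - u) * gaussianPDF m s (q' - u))

lemma int_sq_shift (p x : ℝ) : ∫ u : ℝ, Real.exp (-p * (u - x)^2) = √(π / p) := by
  rw [integral_sub_right_eq_self (fun u : ℝ => Real.exp (-p * u^2)) x]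
  exact integral_gaussian p

lemma int_two (p r x y : ℝ) (hp : 0 < p) (hr : 0 < r) :
    ∫ u : ℝ, Real.exp (-p * (u - x)^2 - r * (u - y)^2)
      = √(π / (p + r)) * Real.exp (-(p * r / (p + r)) * (x - y)^2) := by
  have h : ∀ u : ℝ, Real.exp (-p * (u - x)^2 - r * (u - y)^2)
      = Real.exp (-(p + r) * (u - (p * x + r * y) / (p + r))^2)
        * Real.exp (-(p * r / (p + r)) * (x - y)^2) := by
    intro u
    rw [← Real.exp_add]
    congr 1
    have : p + r ≠ 0 := by positivity
    field_simp
    ring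
  simp_rw [h]
  rw [integral_mul_const, int_sq_shift]

lemma int_double (G H N : ℝ) (hG : 0 < G) (hH : 0 < H) :
    ∫ q : ℝ, ∫ q' : ℝ, Real.exp (-G * (q - q')^2 - H * ((q + q') / 2 - N)^2)
      = π / √(G * H) := by
  have h : ∀ q : ℝ, ∫ q' : ℝ, Real.exp (-G * (q - q')^2 - H * ((q + q') / 2 - N)^2)
      = √(π / (G + H / 4)) * Real.exp (-(G * H / (G + H / 4)) * (q - N)^2) := by
    intro q
    have h1 : ∀ q' : ℝ, -G * (q - q')^2 - H * ((q + q') / 2 - N)^2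
        = -G * (q' - q)^2 - (H / 4) * (q' - (2 * N - q))^2 := by
      intro q'; ring
    simp_rw [h1]
    rw [int_two _ _ _ _ hG (by positivity)]
    congr 2
    ring
  simp_rw [h]
  rw [integral_const_mul, int_sq_shift, ← Real.sqrt_mul (by positivity)]
  have : π / (G + H / 4) * (π / (G * H / (G + H / 4))) = π^2 / (G * H) := by
    field_simp
  rw [this, Real.sqrt_div (by positivity), Real.sqrt_sq pi_pos.le]

lemma kernel_eq (a α m s q q' : ℝ) (hα : 0 < α) (hs : 0 < s) :
    condKernel a α m s q q' = 1 / √(2 * π * (α^2 + s^2)) *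
      Real.exp (-(1 / (8 * s^2)) * (q - q')^2
        - (1 / (2 * (α^2 + s^2))) * ((q + q') / 2 - (m - a))^2) := by
  unfold condKernel
  have hsq : ∀ u : ℝ, √(gaussianPDF m s (q - u) * gaussianPDF m s (q' - u))
      = 1 / (√(2 * π) * s) * Real.exp (-((q - u - m)^2 + (q' - u - m)^2) / (4 * s^2)) := by
    intro u
    rw [Real.sqrt_eq_iff_mul_self_eq_of_pos (by positivity)]
    unfold gaussianPDF
    rw [mul_mul_mul_comm, mul_mul_mul_comm _ (Real.exp _) _ (Real.exp _),
      ← Real.exp_add, ← Real.exp_add]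
    congr 2
    field_simp
    ring
  have h : ∀ u : ℝ, gaussianPDF a α (-u) *
      √(gaussianPDF m s (q - u) * gaussianPDF m s (q' - u))
      = (1 / (√(2 * π) * α) * (1 / (√(2 * π) * s)) *
          Real.exp (-(1 / (8 * s^2)) * (q - q')^2)) *
        Real.exp (-(1 / (2 * α^2)) * (u - (-a))^2
          - (1 / (2 * s^2)) * (u - ((q + q') / 2 - m))^2) := by
    intro u
    rw [hsq]
    unfold gaussianPDF
    rw [mul_mul_mul_comm, mul_assoc _ (Real.exp _) (Real.exp _),
      ← Real.exp_add, ← Real.exp_add]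
    congr 2
    field_simp
    ring
  simp_rw [h]
  rw [integral_const_mul, int_two _ _ _ _ (by positivity) (by positivity),
    sub_eq_add_neg (-(1 / (8 * s^2)) * (q - q')^2), Real.exp_add]
  have e1 : -(1 / (2 * α^2) * (1 / (2 * s^2)) / (1 / (2 * α^2) + 1 / (2 * s^2)))
      * (-a - ((q + q') / 2 - m))^2
      = -(1 / (2 * (α^2 + s^2)) * ((q + q') / 2 - (m - a))^2) := by
    field_simp
    ring
  have e2 : √(π / (1 / (2 * α^2) + 1 / (2 * s^2)))
      = 2 * π * α * s / √(2 * π * (α^2 + s^2)) := by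
    rw [← Real.sqrt_sq (show 0 ≤ 2 * π * α * s by positivity),
      ← Real.sqrt_div (by positivity)]
    congr 1
    field_simp
    ring
  rw [e1, e2]
  have e3 : √(2 * π) * √(2 * π) = 2 * π := Real.mul_self_sqrt (by positivity)
  have e4 : 1 / (√(2 * π) * α) * (1 / (√(2 * π) * s)) = 1 / (2 * π * α * s) := by
    rw [div_mul_div_comm, mul_mul_mul_comm, e3, one_mul, ← mul_assoc]
  rw [e4]
  have : √(2 * π * (α^2 + s^2)) ≠ 0 := by positivity
  generalize √(2 * π * (α^2 + s^2)) = X at *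
  generalize Real.exp (-(1 / (8 * s^2)) * (q - q')^2) = Y at *
  generalize Real.exp _ = Z at *
  field_simp

/-- Eq. (31) of the paper: the overlap (linear fidelity) `Tr[ρ_{S|i} ρ_{S|j}]` of two
conditional system states in the quantum reference frame of environment `E₁`. -/
theorem overlap_of_conditional_system_states
    (a_i a_j m_i m_j : ℝ) (α_i α_j s_i s_j : ℝ)
    (hα_i : 0 < α_i) (hα_j : 0 < α_j) (hs_i : 0 < s_i) (hs_j : 0 < s_j) :
    ∫ q : ℝ, ∫ q' : ℝ, condKernel a_i α_i m_i s_i q q' * condKernel a_j α_j m_j s_j q' q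
      = 2 * s_i * s_j
          * Real.exp (-(a_i - m_i - a_j + m_j)^2
              / (2 * (α_i^2 + α_j^2 + s_i^2 + s_j^2)))
          / Real.sqrt ((s_i^2 + s_j^2) * (α_i^2 + α_j^2 + s_i^2 + s_j^2)) := by
  obtain ⟨A, hA⟩ : ∃ A, A = α_i^2 + s_i^2 := ⟨_, rfl⟩
  obtain ⟨B, hB⟩ : ∃ B, B = α_j^2 + s_j^2 := ⟨_, rfl⟩
  have hV : α_i^2 + α_j^2 + s_i^2 + s_j^2 = A + B := by rw [hA, hB]; ring
  have hA0 : 0 < A := by rw [hA]; positivity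
  have hB0 : 0 < B := by rw [hB]; positivity
  have h : ∀ q q' : ℝ, condKernel a_i α_i m_i s_i q q' * condKernel a_j α_j m_j s_j q' q
      = (1 / √(2 * π * A) * (1 / √(2 * π * B)) *
          Real.exp (-(a_i - m_i - a_j + m_j)^2 / (2 * (A + B)))) *
        Real.exp (-((s_i^2 + s_j^2) / (8 * s_i^2 * s_j^2)) * (q - q')^2
          - ((A + B) / (2 * A * B)) *
            ((q + q') / 2 - (B * (m_i - a_i) + A * (m_j - a_j)) / (A + B))^2) := by
    intro q q'
    rw [kernel_eq _ _ _ _ _ _ hα_i hs_i, kernel_eq _ _ _ _ _ _ hα_j hs_j, ← hA, ← hB,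
      mul_mul_mul_comm, mul_assoc _ (Real.exp _) (Real.exp _), ← Real.exp_add, ← Real.exp_add]
    congr 2
    field_simp
    ring
  simp_rw [h, integral_const_mul]
  rw [int_double _ _ _ (by positivity) (by positivity), hV]
  have e1 : 1 / √(2 * π * A) * (1 / √(2 * π * B)) = 1 / (2 * π * √(A * B)) := by
    rw [div_mul_div_comm, ← Real.sqrt_mul (by positivity), one_mul,
      show 2 * π * A * (2 * π * B) = (2 * π)^2 * (A * B) by ring,
      Real.sqrt_mul (by positivity), Real.sqrt_sq (by positivity)]
  have e2 : √((s_i^2 + s_j^2) / (8 * s_i^2 * s_j^2) * ((A + B) / (2 * A * B)))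
      = √((s_i^2 + s_j^2) * (A + B)) / (4 * s_i * s_j * √(A * B)) := by
    rw [show (s_i^2 + s_j^2) / (8 * s_i^2 * s_j^2) * ((A + B) / (2 * A * B))
      = ((s_i^2 + s_j^2) * (A + B)) / ((4 * s_i * s_j)^2 * (A * B)) by field_simp; ring,
      Real.sqrt_div (by positivity), Real.sqrt_mul (by positivity) (A * B),
      Real.sqrt_sq (by positivity)]
  rw [e1, e2]
  have h1 : √(A * B) ≠ 0 := by positivity
  have h2 : √((s_i^2 + s_j^2) * (A + B)) ≠ 0 := by positivity
  generalize √(A * B) = X at *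
  generalize √((s_i^2 + s_j^2) * (A + B)) = Y at *
  generalize Real.exp _ = Z at *
  field_simp
  ring
end

section
/- Let ψ : ℤ → ℂ be square-summable and not identically zero, let t : ℤ → ℝ be nonnegative and summable, and let T : ℤ → ℂ. Suppose the rank-one factorization T(a)·conj(T(b)) = ∑_{c∈ℤ} t(c)·ψ(a−c)·conj(ψ(b−c)) holds for all a, b ∈ ℤ. Then the support of t contains at most one element, i.e. there exists c₀ ∈ ℤ such that t(c) = 0 for all c ≠ c₀. (This is the key step in the proof of Theorem 1: for the system spectrum {p_i} to be preserved in an environment's quantum reference frame, the diagonal of the conditional environment state must be a point mass, forcing the conditional environment states to be pure and perfectly localised in the position basis.) -/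
/-- Key step of Theorem 1: if a statistical mixture (weights `t c ≥ 0`, summable) of the
translates `n ↦ ψ (n - c)` of a nonzero square-summable wavefunction `ψ : ℤ → ℂ` has a
rank-one kernel `T(a) · conj (T(b))`, then the weight distribution `t` is supported on at
most one point (the conditional environment state is pure and perfectly localised). -/
theorem rank_one_mixture_of_translates_implies_point_mass
    (ψ : ℤ → ℂ) (hψ : Summable fun n : ℤ => ‖ψ n‖ ^ 2) (hne : ψ ≠ 0)
    (t : ℤ → ℝ) (ht0 : ∀ c, 0 ≤ t c) (htsum : Summable t)
    (T : ℤ → ℂ)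
    (hfact : ∀ a b : ℤ,
      T a * (starRingEnd ℂ) (T b)
        = ∑' c : ℤ, (t c : ℂ) * ψ (a - c) * (starRingEnd ℂ) (ψ (b - c))) :
    ∃ c₀ : ℤ, ∀ c : ℤ, c ≠ c₀ → t c = 0 := by
  have hle : ∀ n, ‖ψ n‖ ^ 2 ≤ ∑' n, ‖ψ n‖ ^ 2 := fun n =>
    hψ.le_tsum n (fun _ _ => by positivity)
  set S := ∑' n, ‖ψ n‖ ^ 2 with hS
  have hsum : ∀ a b : ℤ, HasSum
      (fun c : ℤ => (t c : ℂ) * ψ (a - c) * (starRingEnd ℂ) (ψ (b - c)))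
      (T a * (starRingEnd ℂ) (T b)) := by
    intro a b
    rw [hfact a b]
    apply Summable.hasSum
    apply Summable.of_norm_bounded (htsum.mul_right S)
    intro c
    rw [norm_mul, norm_mul, RCLike.norm_conj, Complex.norm_real, Real.norm_of_nonneg (ht0 c),
      mul_assoc]
    apply mul_le_mul_of_nonneg_left _ (ht0 c)
    nlinarith [hle (a - c), hle (b - c), sq_nonneg (‖ψ (a - c)‖ - ‖ψ (b - c)‖)]
  have key : ∀ a b c : ℤ, t c ≠ 0 → T b * ψ (a - c) = T a * ψ (b - c) := by
    intro a b c hc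
    have h1 := ((((hsum a a).mul_left (T b * (starRingEnd ℂ) (T b))).sub
      ((hsum a b).mul_left (T b * (starRingEnd ℂ) (T a)))).sub
      ((hsum b a).mul_left (T a * (starRingEnd ℂ) (T b)))).add
      ((hsum b b).mul_left (T a * (starRingEnd ℂ) (T a)))
    have h2 : HasSum (fun c : ℤ => ((t c * Complex.normSq (T b * ψ (a - c) - T a * ψ (b - c)) : ℝ) : ℂ))
        ((0 : ℝ) : ℂ) := by
      convert h1 using 1
      · rfl
      · funext c
        rw [Complex.ofReal_mul, ← Complex.mul_conj]
        simp only [map_sub, map_mul]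
        ring
      · push_cast
        ring
    rw [Complex.hasSum_ofReal] at h2
    have h3 := (hasSum_zero_iff_of_nonneg
      (fun c => mul_nonneg (ht0 c) (Complex.normSq_nonneg _))).1 h2
    have h4 := congrFun h3 c
    simp only [Pi.zero_apply, mul_eq_zero, hc, false_or, Complex.normSq_eq_zero] at h4
    exact sub_eq_zero.1 h4
  obtain ⟨n0, hn0⟩ := Function.ne_iff.1 hne
  simp only [Pi.zero_apply] at hn0
  by_contra hcon
  push Not at hcon
  obtain ⟨c, -, hc⟩ := hcon 0
  obtain ⟨d, hdc, hd⟩ := hcon c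
  have hT : ∀ c, t c ≠ 0 → T (n0 + c) ≠ 0 := by
    intro c hc h0
    have h1 := hsum (n0 + c) (n0 + c)
    have h2 : HasSum (fun e : ℤ => ((t e * Complex.normSq (ψ (n0 + c - e)) : ℝ) : ℂ))
        ((0 : ℝ) : ℂ) := by
      convert h1 using 1
      · funext e
        rw [Complex.ofReal_mul, ← Complex.mul_conj]
        ring
      · simp [h0]
    rw [Complex.hasSum_ofReal] at h2
    have h3 := (hasSum_zero_iff_of_nonneg
      (fun c => mul_nonneg (ht0 c) (Complex.normSq_nonneg _))).1 h2
    have h4 := congrFun h3 c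
    simp [hc, hn0] at h4
  have hTc := hT c hc
  -- ψ (n + (d - c)) = μ ψ n
  obtain ⟨μ, hμ⟩ : ∃ μ : ℂ, ∀ n, ψ (n + (d - c)) = μ * ψ n := by
    have hl : ψ (n0 + c - d) ≠ 0 := by
      intro h0
      have := key (n0 + d) (n0 + c) d hd
      rw [h0, mul_zero, add_sub_cancel_right] at this
      exact (mul_ne_zero hTc hn0) this
    refine ⟨ψ n0 / ψ (n0 + c - d), fun n => ?_⟩
    have h1 := key (n + d) (n0 + c) c hc
    have h2 := key (n + d) (n0 + c) d hd
    rw [add_sub_cancel_right] at h1 h2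
    rw [← add_sub_assoc]
    field_simp
    apply mul_left_cancel₀ hTc
    linear_combination ψ (n0 + c - d) * h1 - ψ n0 * h2
  have hS0 : 0 < S := lt_of_lt_of_le (by positivity) (hle n0)
  have hμ1 : ‖μ‖ ^ 2 = 1 := by
    have h1 : ∑' n, ‖ψ (n + (d - c))‖ ^ 2 = S :=
      (Equiv.addRight (d - c)).tsum_eq (fun n => ‖ψ n‖ ^ 2)
    simp only [hμ, norm_mul, mul_pow] at h1
    rw [tsum_mul_left, ← hS] at h1
    exact mul_right_cancel₀ hS0.ne' (by rw [h1, one_mul])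
  have hm : ∀ m : ℕ, ‖ψ (n0 + m * (d - c))‖ ^ 2 = ‖ψ n0‖ ^ 2 := by
    intro m
    induction m with
    | zero => simp
    | succ k ih =>
      have : n0 + ((k + 1 : ℕ) : ℤ) * (d - c) = n0 + k * (d - c) + (d - c) := by
        push_cast; ring
      rw [this, hμ, norm_mul, mul_pow, hμ1, one_mul, ih]
  have hinj : Function.Injective (fun m : ℕ => n0 + (m : ℤ) * (d - c)) := by
    intro x y h
    have h' : (x : ℤ) * (d - c) = y * (d - c) := add_left_cancel h
    exact_mod_cast mul_right_cancel₀ (sub_ne_zero.2 hdc) h'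
  have hs := hψ.comp_injective hinj
  have he : ((fun n : ℤ => ‖ψ n‖ ^ 2) ∘ fun m : ℕ => n0 + (m : ℤ) * (d - c))
      = fun _ => ‖ψ n0‖ ^ 2 := funext hm
  rw [he, summable_const_iff] at hs
  simp [hn0] at hs
end
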